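/- arXiv:1002.0384 — 2 statements merged into one kernel-verified Lean document; each statement's English description precedes it below -/
import Mathlib

section
/- Let (s, ⟨·,·⟩) be a metric solvable Lie algebra with Ric = cI + D for some c ∈ ℝ and derivation D of s, and set F := S(ad H) + D, where H is the mean curvature vector. Then c·tr(F) + tr(F²) = 0. Moreover, if c ≤ 0 then tr(F) ≥ 0, with equality if and only if F = 0. -/
noncomputable section

open scoped RealInnerProductSpace

/-! ### Lie-algebraic notions for a bracket given as a bundled bilinear map -/

section Alg

variable {E : Type*} [AddCommGroup E] [Module ℝ E]

/-- `μ` is a Lie bracket: alternating and satisfying the (Leibniz form of the) Jacobi identity. -/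
def IsLieBracket (μ : E →ₗ[ℝ] E →ₗ[ℝ] E) : Prop :=
  (∀ X, μ X X = 0) ∧ ∀ X Y Z, μ X (μ Y Z) = μ (μ X Y) Z + μ Y (μ X Z)

/-- `D` is a derivation of the algebra `(E, μ)`. -/
def IsDeriv (μ : E →ₗ[ℝ] E →ₗ[ℝ] E) (D : E →ₗ[ℝ] E) : Prop :=
  ∀ X Y, D (μ X Y) = μ (D X) Y + μ X (D Y)

/-- The subspace spanned by brackets of elements of `p` and `q`. -/
def bracketSpan (μ : E →ₗ[ℝ] E →ₗ[ℝ] E) (p q : Submodule ℝ E) : Submodule ℝ E :=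
  Submodule.span ℝ {z | ∃ x ∈ p, ∃ y ∈ q, μ x y = z}

/-- Derived series of `(E, μ)`. -/
def derSeries (μ : E →ₗ[ℝ] E →ₗ[ℝ] E) : ℕ → Submodule ℝ E
  | 0 => ⊤
  | k + 1 => bracketSpan μ (derSeries μ k) (derSeries μ k)

/-- `(E, μ)` is a solvable Lie algebra. -/
def IsSolvableB (μ : E →ₗ[ℝ] E →ₗ[ℝ] E) : Prop := ∃ k, derSeries μ k = ⊥

/-- Lower central series of the subalgebra `p` of `(E, μ)`. -/
def lcsOn (μ : E →ₗ[ℝ] E →ₗ[ℝ] E) (p : Submodule ℝ E) : ℕ → Submodule ℝ E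
  | 0 => p
  | k + 1 => bracketSpan μ p (lcsOn μ p k)

/-- The subalgebra `p` of `(E, μ)` is a nilpotent Lie algebra. -/
def IsNilpotentOn (μ : E →ₗ[ℝ] E →ₗ[ℝ] E) (p : Submodule ℝ E) : Prop := ∃ k, lcsOn μ p k = ⊥

/-- `p` is an ideal of `(E, μ)`. -/
def IsIdeal (μ : E →ₗ[ℝ] E →ₗ[ℝ] E) (p : Submodule ℝ E) : Prop := ∀ X : E, ∀ Y ∈ p, μ X Y ∈ p

/-- `p` is the nilradical (maximal nilpotent ideal) of `(E, μ)`. -/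
def IsNilradical (μ : E →ₗ[ℝ] E →ₗ[ℝ] E) (p : Submodule ℝ E) : Prop :=
  IsIdeal μ p ∧ IsNilpotentOn μ p ∧ ∀ q, IsIdeal μ q → IsNilpotentOn μ q → q ≤ p

/-- The natural action `π(f)μ` of `f ∈ End(E)` on bilinear maps:
`(π(f)μ)(X,Y) = f(μ(X,Y)) - μ(fX,Y) - μ(X,fY)`. -/
def piAct (f : E →ₗ[ℝ] E) (μ : E →ₗ[ℝ] E →ₗ[ℝ] E) : E →ₗ[ℝ] E →ₗ[ℝ] E :=
  (LinearMap.llcomp ℝ E E E f) ∘ₗ μ - μ ∘ₗ f - (LinearMap.lcomp ℝ E f) ∘ₗ μ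

/-- The center of `(E, μ)`. -/
def centerB (μ : E →ₗ[ℝ] E →ₗ[ℝ] E) : Submodule ℝ E where
  carrier := {X | μ X = 0}
  add_mem' := by intro a b ha hb; simp only [Set.mem_setOf_eq, map_add] at *; rw [ha, hb, add_zero]
  zero_mem' := by simp only [Set.mem_setOf_eq, map_zero]
  smul_mem' := by intro c a ha; simp only [Set.mem_setOf_eq, map_smul] at *; rw [ha, smul_zero]

end Alg

/-! ### Metric notions -/

section MetricDefs

variable {E : Type*} [NormedAddCommGroup E] [InnerProductSpace ℝ E] [FiniteDimensional ℝ E]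

/-- The transpose of an operator with respect to the inner product. -/
def transp (f : E →ₗ[ℝ] E) : E →ₗ[ℝ] E := LinearMap.adjoint f

/-- The symmetric part `S(f) = (f + fᵗ)/2` of an operator. -/
def symPart (f : E →ₗ[ℝ] E) : E →ₗ[ℝ] E := (1 / 2 : ℝ) • (f + transp f)

variable (E) in
/-- A fixed orthonormal basis of `E`. -/
def stdONB : OrthonormalBasis (Fin (Module.finrank ℝ E)) ℝ E := stdOrthonormalBasis ℝ E

/-- The operator `R` appearing in the formula for the Ricci operator of a metric Lie algebra:
`⟨R X, X⟩ = -(1/2) Σ ⟨[X,Xᵢ],Xⱼ⟩² + (1/4) Σ ⟨[Xᵢ,Xⱼ],X⟩²` for any orthonormal basis `{Xᵢ}`. -/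
def Rop (μ : E →ₗ[ℝ] E →ₗ[ℝ] E) : E →ₗ[ℝ] E :=
  (-(1 / 2 : ℝ)) • ∑ i, (transp (μ (stdONB E i))) ∘ₗ (μ (stdONB E i))
    + (1 / 4 : ℝ) • ∑ i, (μ (stdONB E i)) ∘ₗ (transp (μ (stdONB E i)))

/-- The symmetric operator `B` defined by the Killing form: `⟨B X, X⟩ = tr((ad X)²)`. -/
def Bop (μ : E →ₗ[ℝ] E →ₗ[ℝ] E) : E →ₗ[ℝ] E :=
  ∑ i, (((LinearMap.trace ℝ E) ∘ₗ (LinearMap.lcomp ℝ E (μ (stdONB E i))) ∘ₗ μ).smulRight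
    (stdONB E i))

/-- The mean curvature vector `H`, characterized by `⟨H, X⟩ = tr (ad X)`. -/
def meanCurv (μ : E →ₗ[ℝ] E →ₗ[ℝ] E) : E :=
  ∑ i, (LinearMap.trace ℝ E (μ (stdONB E i))) • (stdONB E i : E)

/-- The Ricci operator `Ric = R - (1/2) B - S(ad H)` of a metric Lie algebra. -/
def Ric (μ : E →ₗ[ℝ] E →ₗ[ℝ] E) : E →ₗ[ℝ] E :=
  Rop μ - (1 / 2 : ℝ) • Bop μ - symPart (μ (meanCurv μ))

/-- `(E, μ, ⟨⬝,⬝⟩)` is a solsoliton: `Ric = c I + D` for some `c ∈ ℝ` and derivation `D`. -/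
def IsSolsoliton (μ : E →ₗ[ℝ] E →ₗ[ℝ] E) : Prop :=
  ∃ (c : ℝ) (D : E →ₗ[ℝ] E), IsDeriv μ D ∧ Ric μ = c • LinearMap.id + D

/-- The natural inner product on bilinear maps, `⟨μ,ν⟩ = Σ ⟨μ(Xᵢ,Xⱼ), ν(Xᵢ,Xⱼ)⟩`. -/
def binner (μ ν : E →ₗ[ℝ] E →ₗ[ℝ] E) : ℝ :=
  ∑ i, ∑ j, ⟪μ (stdONB E i) (stdONB E j), ν (stdONB E i) (stdONB E j)⟫

/-- Orthogonal projection onto a subspace, as an endomorphism of `E`. -/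
def projL (p : Submodule ℝ E) : E →ₗ[ℝ] E :=
  p.subtype ∘ₗ (Submodule.orthogonalProjectionOnto p).toLinearMap

/-- An orthonormal basis of the subspace `p`, as a family of vectors of `E`. -/
def onbOf (p : Submodule ℝ E) : Fin (Module.finrank ℝ ↥p) → E :=
  fun i => ((stdOrthonormalBasis ℝ ↥p) i : E)

/-- The restriction `ad X |_p` of `ad X` to the subspace `p`, as an endomorphism of `E`
(it kills `pᗮ`). -/
def adOn (μ : E →ₗ[ℝ] E →ₗ[ℝ] E) (p : Submodule ℝ E) (X : E) : E →ₗ[ℝ] E :=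
  (μ X) ∘ₗ projL p

/-- The Ricci operator of the restricted metric Lie algebra `(p, μ|ₚ, ⟨⬝,⬝⟩|ₚ)`, for `p` a
bracket-closed subspace, realized as an endomorphism of `E` killing `pᗮ`.  (For `p` nilpotent
this is the full Ricci operator of `p`.) -/
def RopOn (μ : E →ₗ[ℝ] E →ₗ[ℝ] E) (p : Submodule ℝ E) : E →ₗ[ℝ] E :=
  (-(1 / 2 : ℝ)) • ∑ i, (transp (adOn μ p (onbOf p i))) ∘ₗ (adOn μ p (onbOf p i))
    + (1 / 4 : ℝ) • ∑ i, (adOn μ p (onbOf p i)) ∘ₗ (transp (adOn μ p (onbOf p i)))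

/-- The metric nilpotent Lie algebra `(p, μ|ₚ, ⟨⬝,⬝⟩|ₚ)` is a nilsoliton with Ricci operator
`c I + D₁`, where `D₁` is (induced by) a derivation of `p`. -/
def IsNilsolitonOn (μ : E →ₗ[ℝ] E →ₗ[ℝ] E) (p : Submodule ℝ E) (c : ℝ) (D₁ : E →ₗ[ℝ] E) :
    Prop :=
  (∀ X ∈ p, D₁ X ∈ p) ∧ (∀ X ∈ p, ∀ Y ∈ p, D₁ (μ X Y) = μ (D₁ X) Y + μ X (D₁ Y)) ∧
    ∀ X ∈ p, RopOn μ p X = c • X + D₁ X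

end MetricDefs

section TraceIdentities

variable {E : Type*} [NormedAddCommGroup E] [InnerProductSpace ℝ E]

lemma sum_linearMap_comp {ι : Type*} (s : Finset ι) (f : ι → E →ₗ[ℝ] E) (g : E →ₗ[ℝ] E) :
    (∑ i ∈ s, f i) ∘ₗ g = ∑ i ∈ s, f i ∘ₗ g :=
  Finset.sum_mul s f g

lemma linearMap_comp_sum {ι : Type*} (s : Finset ι) (f : ι → E →ₗ[ℝ] E) (g : E →ₗ[ℝ] E) :
    g ∘ₗ (∑ i ∈ s, f i) = ∑ i ∈ s, g ∘ₗ f i :=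
  Finset.mul_sum s f g

lemma trace_comp_comm (f g : E →ₗ[ℝ] E) :
    LinearMap.trace ℝ E (f ∘ₗ g) = LinearMap.trace ℝ E (g ∘ₗ f) :=
  LinearMap.trace_mul_comm ℝ f g

lemma IsDeriv.apply_eq {μ : E →ₗ[ℝ] E →ₗ[ℝ] E} {D : E →ₗ[ℝ] E} (hD : IsDeriv μ D) (x : E) :
    μ (D x) = D ∘ₗ μ x - μ x ∘ₗ D := by
  ext y
  simp [hD x y]

lemma IsLieBracket.skew {μ : E →ₗ[ℝ] E →ₗ[ℝ] E} (hμ : IsLieBracket μ) (x y : E) :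
    μ x y = -μ y x :=
  (LinearMap.IsAlt.neg (B := μ) hμ.1 y x).symm

lemma IsLieBracket.isDeriv {μ : E →ₗ[ℝ] E →ₗ[ℝ] E} (hμ : IsLieBracket μ) (x : E) :
    IsDeriv μ (μ x) :=
  hμ.2 x

variable [FiniteDimensional ℝ E]

lemma trace_eq_sum_stdONB (f : E →ₗ[ℝ] E) :
    LinearMap.trace ℝ E f = ∑ i, ⟪f (stdONB E i), stdONB E i⟫ := by
  rw [LinearMap.trace_eq_sum_inner f (stdONB E)]
  exact Finset.sum_congr rfl fun i _ => real_inner_comm _ _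

lemma inner_transp_left (f : E →ₗ[ℝ] E) (x y : E) : ⟪transp f x, y⟫ = ⟪x, f y⟫ :=
  LinearMap.adjoint_inner_left f y x

lemma inner_transp_right (f : E →ₗ[ℝ] E) (x y : E) : ⟪x, transp f y⟫ = ⟪f x, y⟫ :=
  LinearMap.adjoint_inner_right f x y

lemma trace_comp_transp {M : E →ₗ[ℝ] E} (hM : M.IsSymmetric) (f : E →ₗ[ℝ] E) :
    LinearMap.trace ℝ E (M ∘ₗ transp f) = LinearMap.trace ℝ E (M ∘ₗ f) := by
  rw [trace_comp_comm M f, trace_eq_sum_stdONB, trace_eq_sum_stdONB]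
  refine Finset.sum_congr rfl fun i _ => ?_
  rw [LinearMap.comp_apply, LinearMap.comp_apply, hM, inner_transp_left, real_inner_comm]

lemma trace_comp_symPart {M : E →ₗ[ℝ] E} (hM : M.IsSymmetric) (f : E →ₗ[ℝ] E) :
    LinearMap.trace ℝ E (M ∘ₗ symPart f) = LinearMap.trace ℝ E (M ∘ₗ f) := by
  rw [symPart, LinearMap.comp_smul, LinearMap.comp_add, map_smul, map_add, trace_comp_transp hM,
    smul_eq_mul]
  ring

lemma trace_transp_comp (f g : E →ₗ[ℝ] E) :
    LinearMap.trace ℝ E (transp f ∘ₗ g) = ∑ j, ⟪g (stdONB E j), f (stdONB E j)⟫ := by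
  simp only [trace_eq_sum_stdONB, LinearMap.comp_apply, inner_transp_left]

lemma isSymmetric_transp_comp (f : E →ₗ[ℝ] E) : (transp f ∘ₗ f).IsSymmetric := fun x y => by
  simp only [LinearMap.comp_apply, inner_transp_left, inner_transp_right]

lemma isSymmetric_comp_transp (f : E →ₗ[ℝ] E) : (f ∘ₗ transp f).IsSymmetric := fun _ _ =>
  (inner_transp_right f _ _).symm.trans (inner_transp_left f _ _)

lemma LinearMap.IsSymmetric.eq_zero_of_trace_comp_self {F : E →ₗ[ℝ] E} (hF : F.IsSymmetric)
    (h : LinearMap.trace ℝ E (F ∘ₗ F) = 0) : F = 0 := by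
  simp only [trace_eq_sum_stdONB, LinearMap.comp_apply, hF _ (stdONB E _)] at h
  rw [Finset.sum_eq_zero_iff_of_nonneg fun i _ => real_inner_self_nonneg] at h
  exact (stdONB E).toBasis.ext fun i => by simpa using h i (Finset.mem_univ i)

lemma LinearMap.IsSymmetric.trace_comp_self_nonneg {F : E →ₗ[ℝ] E} (hF : F.IsSymmetric) :
    0 ≤ LinearMap.trace ℝ E (F ∘ₗ F) := by
  simp only [trace_eq_sum_stdONB, LinearMap.comp_apply, hF _ (stdONB E _)]
  exact Finset.sum_nonneg fun i _ => real_inner_self_nonneg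

lemma isSymmetric_Rop (μ : E →ₗ[ℝ] E →ₗ[ℝ] E) : (Rop μ).IsSymmetric := by
  refine ((LinearMap.isSymmetric_sum _ fun i _ => isSymmetric_transp_comp _).smul ?_).add
    ((LinearMap.isSymmetric_sum _ fun i _ => isSymmetric_comp_transp _).smul ?_) <;> simp

lemma inner_Bop (μ : E →ₗ[ℝ] E →ₗ[ℝ] E) (x y : E) :
    ⟪Bop μ x, y⟫ = LinearMap.trace ℝ E (μ x ∘ₗ μ y) := by
  conv_rhs => rw [← (stdONB E).sum_repr' y, map_sum, linearMap_comp_sum]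
  simp [Bop, sum_inner, inner_smul_left, LinearMap.lcomp_apply', LinearMap.comp_smul, mul_comm]

lemma isSymmetric_Bop (μ : E →ₗ[ℝ] E →ₗ[ℝ] E) : (Bop μ).IsSymmetric := fun x y => by
  rw [inner_Bop, real_inner_comm, inner_Bop, trace_comp_comm]

lemma IsDeriv.trace_Bop_comp {μ : E →ₗ[ℝ] E →ₗ[ℝ] E} {D : E →ₗ[ℝ] E} (hD : IsDeriv μ D) :
    LinearMap.trace ℝ E (Bop μ ∘ₗ D) = 0 := by
  rw [trace_eq_sum_stdONB]
  refine Finset.sum_eq_zero fun i _ => ?_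
  rw [LinearMap.comp_apply, inner_Bop, hD.apply_eq, LinearMap.sub_comp, map_sub, sub_eq_zero,
    trace_comp_comm (D ∘ₗ _), ← LinearMap.comp_assoc]

lemma IsDeriv.trace_Rop_comp {μ : E →ₗ[ℝ] E →ₗ[ℝ] E} {D : E →ₗ[ℝ] E} (hμ : IsLieBracket μ)
    (hD : IsDeriv μ D) : LinearMap.trace ℝ E (Rop μ ∘ₗ D) = 0 := by
  have hskew : ∑ i, LinearMap.trace ℝ E (transp (μ (stdONB E i)) ∘ₗ μ (D (stdONB E i))) =
      ∑ i, LinearMap.trace ℝ E (transp (μ (stdONB E i)) ∘ₗ (μ (stdONB E i) ∘ₗ D)) := by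
    simp only [trace_transp_comp, LinearMap.comp_apply]
    rw [Finset.sum_comm]
    refine Finset.sum_congr rfl fun i _ => Finset.sum_congr rfl fun j _ => ?_
    rw [hμ.skew (D _), hμ.skew (stdONB E j), inner_neg_neg]
  have hcyc : ∀ i, LinearMap.trace ℝ E (μ (stdONB E i) ∘ₗ (transp (μ (stdONB E i)) ∘ₗ D)) =
      LinearMap.trace ℝ E (transp (μ (stdONB E i)) ∘ₗ μ (D (stdONB E i))) +
        LinearMap.trace ℝ E (transp (μ (stdONB E i)) ∘ₗ (μ (stdONB E i) ∘ₗ D)) := fun i => by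
    rw [hD.apply_eq, LinearMap.comp_sub, map_sub, sub_add_cancel, trace_comp_comm,
      LinearMap.comp_assoc]
  simp only [Rop, LinearMap.add_comp, LinearMap.smul_comp, sum_linearMap_comp, map_add, map_smul,
    map_sum, hcyc, Finset.sum_add_distrib, hskew, LinearMap.comp_assoc, smul_eq_mul]
  ring

end TraceIdentities

/-- if `Ric = c I + D` with `D` a derivation, and `F := S(ad H) + D`, then
`c tr F + tr F² = 0`; moreover if `c ≤ 0` then `tr F ≥ 0`, with equality iff `F = 0`. -/
theorem trace_F_identity
    {E : Type*} [NormedAddCommGroup E] [InnerProductSpace ℝ E] [FiniteDimensional ℝ E]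
    (μ : E →ₗ[ℝ] E →ₗ[ℝ] E) (hLie : IsLieBracket μ) (hsolv : IsSolvableB μ)
    (c : ℝ) (D : E →ₗ[ℝ] E) (hD : IsDeriv μ D) (hRic : Ric μ = c • LinearMap.id + D)
    (F : E →ₗ[ℝ] E) (hF : F = symPart (μ (meanCurv μ)) + D) :
    c * LinearMap.trace ℝ E F + LinearMap.trace ℝ E (F ∘ₗ F) = 0 ∧
      (c ≤ 0 → 0 ≤ LinearMap.trace ℝ E F ∧ (LinearMap.trace ℝ E F = 0 ↔ F = 0)) := by
  have hM : c • LinearMap.id + F = Rop μ - (1 / 2 : ℝ) • Bop μ := by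
    rw [hF, ← add_assoc, add_right_comm, ← hRic, Ric, sub_add_cancel]
  have hMsymm : (c • LinearMap.id + F).IsSymmetric := by
    rw [hM]
    exact (isSymmetric_Rop μ).sub ((isSymmetric_Bop μ).smul (by simp))
  have hFsymm : F.IsSymmetric := by
    simpa using hMsymm.sub ((LinearMap.IsSymmetric.id (𝕜 := ℝ) (E := E)).smul (c := c) (by simp))
  have hder : ∀ G : E →ₗ[ℝ] E, IsDeriv μ G →
      LinearMap.trace ℝ E ((c • LinearMap.id + F) ∘ₗ G) = 0 := fun G hG => by
    rw [hM, LinearMap.sub_comp, LinearMap.smul_comp, map_sub, map_smul, hG.trace_Rop_comp hLie,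
      hG.trace_Bop_comp, smul_zero, sub_zero]
  have hid : c * LinearMap.trace ℝ E F + LinearMap.trace ℝ E (F ∘ₗ F) = 0 := by
    have h : LinearMap.trace ℝ E ((c • LinearMap.id + F) ∘ₗ F) = 0 := by
      conv_lhs => enter [2, 2]; rw [hF]
      rw [LinearMap.comp_add, map_add, trace_comp_symPart hMsymm, hder _ (hLie.isDeriv _),
        hder D hD, add_zero]
    simpa [LinearMap.add_comp, LinearMap.smul_comp] using h
  have hnonneg := hFsymm.trace_comp_self_nonneg
  refine ⟨hid, fun hc => ?_⟩
  have hzero : LinearMap.trace ℝ E F = 0 ↔ F = 0 :=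
    ⟨fun h => hFsymm.eq_zero_of_trace_comp_self (by simpa [h] using hid), fun h => by simp [h]⟩
  refine ⟨?_, hzero⟩
  by_contra! hneg
  have hsq : LinearMap.trace ℝ E (F ∘ₗ F) = 0 := by nlinarith
  exact hneg.ne (hzero.2 (hFsymm.eq_zero_of_trace_comp_self hsq))
end
end

section
/- Let (n, ⟨·,·⟩) be a metric nilpotent Lie algebra and let A : n → n be a derivation of n that is symmetric with respect to ⟨·,·⟩. Write n = n₁ ⊕ ... ⊕ n_r for the orthogonal decomposition determined by the descending central series, i.e. n_i ⊕ ... ⊕ n_r = C^{i-1}(n) (so that [n, n] = n₂ ⊕ ... ⊕ n_r, [n,[n,n]] = n₃ ⊕ ... ⊕ n_r, etc.). Then A leaves each subspace n_i invariant, and tr(A ∘ ad X) = 0 for every X ∈ n. -/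
noncomputable section

open scoped RealInnerProductSpace

/-- Bracketing an element of `p` with an element of a term of the lower central series of `p`
lands in the next term. -/
theorem bracket_mem_lcsOn_succ {E : Type*} [AddCommGroup E] [Module ℝ E]
    (μ : E →ₗ[ℝ] E →ₗ[ℝ] E) (p : Submodule ℝ E) {i : ℕ} {X Y : E} (hX : X ∈ p)
    (hY : Y ∈ lcsOn μ p i) : μ X Y ∈ lcsOn μ p (i + 1) :=
  Submodule.subset_span ⟨X, hX, Y, hY, rfl⟩

/-- A derivation preserves every term of the lower central series. -/
theorem IsDeriv.map_lcsOn_mem {E : Type*} [AddCommGroup E] [Module ℝ E]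
    {μ : E →ₗ[ℝ] E →ₗ[ℝ] E} {D : E →ₗ[ℝ] E} (hD : IsDeriv μ D) (i : ℕ) :
    ∀ X ∈ lcsOn μ ⊤ i, D X ∈ lcsOn μ ⊤ i := by
  induction i with
  | zero => exact fun X _ => Submodule.mem_top
  | succ i ih =>
    have hle : lcsOn μ ⊤ (i + 1) ≤ (lcsOn μ ⊤ (i + 1)).comap D := by
      refine Submodule.span_le.2 ?_
      rintro _ ⟨X, hX, Y, hY, rfl⟩
      change D (μ X Y) ∈ lcsOn μ ⊤ (i + 1)
      rw [hD]
      exact add_mem (bracket_mem_lcsOn_succ μ ⊤ Submodule.mem_top hY)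
        (bracket_mem_lcsOn_succ μ ⊤ hX (ih Y hY))
    exact hle

/-- let `(n, ⟨⬝,⬝⟩)` be a metric nilpotent Lie algebra and `A` a symmetric
derivation.  With `nᵢ₊₁ := Cⁱ(n) ⊓ (Cⁱ⁺¹(n))ᗮ` the orthogonal decomposition determined by the
descending central series, `A` leaves each `nᵢ` invariant, and `tr (A ∘ ad X) = 0` for all `X`. -/
theorem symmetric_derivation_invariance_and_trace
    {E : Type*} [NormedAddCommGroup E] [InnerProductSpace ℝ E] [FiniteDimensional ℝ E]
    (μ : E →ₗ[ℝ] E →ₗ[ℝ] E) (hLie : IsLieBracket μ) (hnilp : IsNilpotentOn μ ⊤)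
    (A : E →ₗ[ℝ] E) (hA : IsDeriv μ A) (hAsym : A.IsSymmetric) :
    (∀ i : ℕ, ∀ X ∈ lcsOn μ ⊤ i ⊓ (lcsOn μ ⊤ (i + 1))ᗮ,
        A X ∈ lcsOn μ ⊤ i ⊓ (lcsOn μ ⊤ (i + 1))ᗮ) ∧
      ∀ X : E, LinearMap.trace ℝ E (A ∘ₗ μ X) = 0 := by
  have hinv := hA.map_lcsOn_mem
  refine ⟨fun i X hX => ⟨hinv i X hX.1, ?_⟩, fun X => ?_⟩
  · refine (Submodule.mem_orthogonal _ _).2 ?_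
    intro u hu
    rw [← hAsym u X]
    exact (Submodule.mem_orthogonal _ _).1 hX.2 _ (hinv _ u hu)
  · obtain ⟨k, hk⟩ := hnilp
    have hpow : ∀ (j : ℕ) (Y : E), ((A ∘ₗ μ X) ^ j) Y ∈ lcsOn μ ⊤ j := by
      intro j
      induction j with
      | zero => exact fun Y => Submodule.mem_top
      | succ j ih =>
        intro Y
        rw [pow_succ', Module.End.mul_apply]
        exact hinv (j + 1) _ (bracket_mem_lcsOn_succ μ ⊤ Submodule.mem_top (ih Y))
    have hnil : IsNilpotent (A ∘ₗ μ X) := by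
      refine ⟨k, LinearMap.ext fun Y => ?_⟩
      have hY := hpow k Y
      rw [hk] at hY
      exact (Submodule.mem_bot ℝ).1 hY
    exact (LinearMap.isNilpotent_trace_of_isNilpotent hnil).eq_zero
end
end
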